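/- Let t < T, let ψ_1, …, ψ_5 be continuously differentiable real functions on [t,T], let (φ_j)_{j≥0} be the normalized Legendre system on [t,T], and let C_{j_5…j_1} = ∫_t^T ψ_5(t_5)φ_{j_5}(t_5) ⋯ ∫_t^{t_2} ψ_1(t_1)φ_{j_1}(t_1) dt_1 ⋯ dt_5 be the iterated simplex Fourier coefficients, and I_5 = ‖K‖²_{L²([t,T]⁵)} for the corresponding kernel K. Then for every ε ∈ (0,1) there exists a constant C, independent of p, such that for all integers p ≥ 1: 0 ≤ I_5 − Σ_{j_1,…,j_5=0}^{p} C_{j_5…j_1}² ≤ C/p^{1−ε}. -/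

import Mathlib

open MeasureTheory

/-- Iterated simplex integral with lower limit `a`: for a list `[g₁, …, gₙ]`
(outermost integrand first),
`simplexIntegral a [g₁, …, gₙ] b = ∫_a^b g₁(s) · simplexIntegral a [g₂, …, gₙ] s ds`. -/
noncomputable def simplexIntegral (a : ℝ) : List (ℝ → ℝ) → ℝ → ℝ
  | [], _ => 1
  | f :: fs, b => ∫ s in a..b, f s * simplexIntegral a fs s

/-- The kernel `K(t₁,…,t_k) = ψ₁(t₁)⋯ψ_k(t_k)` for `t₁ < ⋯ < t_k`, and `0` otherwise. -/
noncomputable def kernelK {k : ℕ} (ψ : Fin k → ℝ → ℝ) (x : Fin k → ℝ) : ℝ :=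
  if StrictMono x then ∏ l, ψ l (x l) else 0

/-- The product measure on `[t,T]^k`. -/
noncomputable def boxMeasure (t T : ℝ) (k : ℕ) : Measure (Fin k → ℝ) :=
  Measure.pi fun _ => volume.restrict (Set.Icc t T)

/-- The Legendre polynomial `P_n(x) = (1/(2^n n!)) dⁿ/dxⁿ (x²−1)ⁿ` (Rodrigues formula). -/
noncomputable def legendreP (n : ℕ) (x : ℝ) : ℝ :=
  (1 / (2 ^ n * (Nat.factorial n) : ℝ)) * iteratedDeriv n (fun y : ℝ => (y ^ 2 - 1) ^ n) x

/-- The normalized Legendre system on `[t,T]`: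
`φ_j(x) = √((2j+1)/(T−t)) · P_j((2x − (T+t))/(T−t))`. -/
noncomputable def legendreSys (t T : ℝ) (j : ℕ) (x : ℝ) : ℝ :=
  Real.sqrt ((2 * (j : ℝ) + 1) / (T - t)) * legendreP j ((2 * x - (T + t)) / (T - t))

/-- The iterated simplex Fourier–Legendre coefficient
`C_{j_k…j_1} = ∫_t^T ψ_k(t_k)φ_{j_k}(t_k) ⋯ ∫_t^{t_2} ψ_1(t_1)φ_{j_1}(t_1) dt_1⋯dt_k`. -/
noncomputable def legCoef (t T : ℝ) {k : ℕ} (ψ : Fin k → ℝ → ℝ) (j : Fin k → ℕ) : ℝ :=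
  simplexIntegral t
    ((List.ofFn fun l => fun s : ℝ => ψ l s * legendreSys t T (j l) s).reverse) T

section LegendrePolynomials

open Polynomial

/-- The Legendre polynomial given by the Rodrigues formula, as an element of `ℝ[X]`. -/
noncomputable def legendrePoly (n : ℕ) : ℝ[X] :=
  C (1 / (2 ^ n * (Nat.factorial n) : ℝ)) * derivative^[n] ((X ^ 2 - 1) ^ n)

theorem iteratedDeriv_polynomial_eval (q : ℝ[X]) (n : ℕ) :
    iteratedDeriv n (fun x => q.eval x) = fun x => (derivative^[n] q).eval x := by
  induction n with
  | zero => simp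
  | succ n ih =>
    rw [iteratedDeriv_succ, ih, Function.iterate_succ_apply']
    ext x
    simp

theorem legendreP_eq_eval (n : ℕ) (x : ℝ) : legendreP n x = (legendrePoly n).eval x := by
  have h := congrFun (iteratedDeriv_polynomial_eval ((X ^ 2 - 1) ^ n) n) x
  simp only [eval_pow, eval_sub, eval_X, eval_one] at h
  simp [legendreP, legendrePoly, h]

theorem iterate_derivative_rodrigues_ode (n m : ℕ) :
    (X ^ 2 - 1) * derivative^[m + 2] ((X ^ 2 - 1 : ℝ[X]) ^ n)
      + (2 * ((m : ℝ[X]) + 1) - 2 * (n : ℝ[X])) * X * derivative^[m + 1] ((X ^ 2 - 1 : ℝ[X]) ^ n)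
      + ((m : ℝ[X]) + 1) * ((m : ℝ[X]) - 2 * (n : ℝ[X])) * derivative^[m] ((X ^ 2 - 1 : ℝ[X]) ^ n) = 0 := by
  induction m with
  | zero =>
    have h : (X ^ 2 - 1 : ℝ[X]) * derivative ((X ^ 2 - 1 : ℝ[X]) ^ n)
        - 2 * (n : ℝ[X]) * X * (X ^ 2 - 1 : ℝ[X]) ^ n = 0 := by
      rcases n with _ | n
      · simp
      · have e : (C 2 : ℝ[X]) = 2 := rfl
        simp [derivative_pow, e]
        ring
    have h' := congrArg derivative h
    simp only [derivative_sub, derivative_mul, derivative_X, derivative_natCast,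
      derivative_zero, derivative_X_pow, derivative_one, derivative_ofNat] at h'
    simp only [Function.iterate_succ, Function.iterate_zero, Function.comp, id]
    have e : C ((2 : ℕ) : ℝ) = (2 : ℝ[X]) := rfl
    rw [e] at h'
    push_cast
    linear_combination h'
  | succ m ih =>
    have h' := congrArg derivative ih
    have e : C ((2 : ℕ) : ℝ) = (2 : ℝ[X]) := rfl
    simp only [derivative_add, derivative_sub, derivative_mul, derivative_X, derivative_natCast,
      derivative_zero, derivative_X_pow, derivative_one, derivative_ofNat,
      ← Function.iterate_succ_apply', e] at h'
    push_cast
    simp only [show m + 1 + 2 = (m + 2).succ from rfl, show m + 1 + 1 = (m + 1).succ from rfl] at *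
    linear_combination h'

theorem legendrePoly_ode (n : ℕ) :
    derivative ((1 - X ^ 2) * derivative (legendrePoly n))
      = -C ((n : ℝ) * (n + 1)) * legendrePoly n := by
  have h := iterate_derivative_rodrigues_ode n n
  have e : C ((2 : ℕ) : ℝ) = (2 : ℝ[X]) := rfl
  simp only [legendrePoly, derivative_mul, derivative_C, derivative_sub, derivative_one,
    derivative_X_pow, derivative_zero, ← Function.iterate_succ_apply', e, map_mul,
    map_add, map_natCast, map_one]
  simp only [Function.iterate_succ_apply'] at *
  linear_combination (-C (1 / (2 ^ n * (Nat.factorial n) : ℝ))) * h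

theorem natDegree_legendrePoly (n : ℕ) : (legendrePoly n).natDegree = n := by
  have hm : (X ^ 2 - 1 : ℝ[X]).Monic := by
    simpa using monic_X_pow_sub_C (1 : ℝ) (two_ne_zero)
  have hd : (X ^ 2 - 1 : ℝ[X]).natDegree = 2 := by
    simpa using natDegree_X_pow_sub_C (n := 2) (r := (1 : ℝ))
  have hu : ((X ^ 2 - 1 : ℝ[X]) ^ n).natDegree = n + n := by
    rw [hm.natDegree_pow, hd]; ring
  apply le_antisymm
  · refine (natDegree_C_mul_le _ _).trans ?_
    refine (natDegree_iterate_derivative _ _).trans ?_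
    omega
  · apply le_natDegree_of_ne_zero
    rw [legendrePoly, coeff_C_mul, coeff_iterate_derivative]
    have : ((X ^ 2 - 1 : ℝ[X]) ^ n).coeff (n + n) = 1 := by
      rw [← hu]; exact (hm.pow n).coeff_natDegree
    rw [this]
    have : (n + n).descFactorial n ≠ 0 := by
      rw [Ne, Nat.descFactorial_eq_zero_iff_lt]; omega
    simp [this, Nat.factorial_ne_zero]

theorem legendrePoly_eval_eq_hasseDeriv (n : ℕ) (x : ℝ) :
    (legendrePoly n).eval x = (1 / 2 ^ n) * (taylor x ((X ^ 2 - 1) ^ n)).coeff n := by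
  rw [taylor_coeff, legendrePoly, ← factorial_smul_hasseDeriv]
  simp [eval_mul]
  field_simp

theorem legendrePoly_eval_one (n : ℕ) : (legendrePoly n).eval 1 = 1 := by
  rw [legendrePoly_eval_eq_hasseDeriv]
  have : taylor (1 : ℝ) ((X ^ 2 - 1) ^ n) = (X + C 2) ^ n * X ^ n := by
    simp only [taylor_apply, pow_comp, sub_comp, X_comp, one_comp, ← mul_pow]
    congr 1
    have e : (C 2 : ℝ[X]) = 2 := rfl
    rw [e, map_one]; ring
  rw [this, coeff_mul_X_pow', coeff_X_add_C_pow]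
  simp

theorem legendrePoly_eval_neg_one (n : ℕ) : (legendrePoly n).eval (-1) = (-1) ^ n := by
  rw [legendrePoly_eval_eq_hasseDeriv]
  have : taylor (-1 : ℝ) ((X ^ 2 - 1) ^ n) = (X + C (-2)) ^ n * X ^ n := by
    simp only [taylor_apply, pow_comp, sub_comp, X_comp, one_comp, ← mul_pow]
    congr 1
    have e : (C 2 : ℝ[X]) = 2 := rfl
    rw [map_neg, map_neg, e, map_one]; ring
  rw [this, coeff_mul_X_pow', coeff_X_add_C_pow]
  simp [neg_pow (2 : ℝ)]; field_simp

theorem exists_eq_sum_legendrePoly {q : ℝ[X]} {m : ℕ} (hq : q.natDegree ≤ m) :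
    ∃ c : ℕ → ℝ, q = ∑ i ∈ Finset.range (m + 1), C (c i) * legendrePoly i := by
  have hne : ∀ i, legendrePoly i ≠ 0 := fun i h => by
    have := legendrePoly_eval_one i
    simp [h] at this
  let S : Polynomial.Sequence ℝ := ⟨legendrePoly, fun i => by
    rw [degree_eq_natDegree (hne i), natDegree_legendrePoly]⟩
  have hs := S.span_degreeLE (m := m) fun i _ =>
    (leadingCoeff_ne_zero.2 (hne i)).isUnit
  have hmem : q ∈ degreeLE ℝ (m : ℕ) := mem_degreeLE.2 (natDegree_le_iff_degree_le.1 hq)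
  rw [← hs] at hmem
  rw [show Set.Iic m = ((Finset.range (m + 1) : Finset ℕ) : Set ℕ) by
    ext; simp, Submodule.mem_span_image_finset_iff_exists_fun'] at hmem
  obtain ⟨c, hc⟩ := hmem
  exact ⟨c, by simp only [← hc, smul_eq_C_mul]; rfl⟩

theorem integral_eval_derivative (q : ℝ[X]) (a b : ℝ) :
    ∫ x in a..b, (derivative q).eval x = q.eval b - q.eval a :=
  intervalIntegral.integral_eq_sub_of_hasDerivAt (fun x _ => q.hasDerivAt x)
    ((derivative q).continuous.intervalIntegrable _ _)

theorem integral_legendrePoly_mul_of_ne {m n : ℕ} (h : m ≠ n) :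
    ∫ x in (-1 : ℝ)..1, (legendrePoly m * legendrePoly n).eval x = 0 := by
  have hW := integral_eval_derivative ((1 - X ^ 2) * derivative (legendrePoly m) * legendrePoly n
    - (1 - X ^ 2) * derivative (legendrePoly n) * legendrePoly m) (-1) 1
  have e : derivative ((1 - X ^ 2) * derivative (legendrePoly m) * legendrePoly n
    - (1 - X ^ 2) * derivative (legendrePoly n) * legendrePoly m)
      = C ((n : ℝ) * (n + 1) - m * (m + 1)) * (legendrePoly m * legendrePoly n) := by
    rw [derivative_sub, derivative_mul, derivative_mul (f := (1 - X ^ 2) * derivative _),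
      legendrePoly_ode, legendrePoly_ode, map_sub]
    ring
  rw [e] at hW
  simp only [eval_C_mul, intervalIntegral.integral_const_mul] at hW
  simp at hW
  rcases hW with hW | hW
  · exfalso
    have : (n : ℤ) * (n + 1) - m * (m + 1) = 0 := by exact_mod_cast hW
    have h2 : ((n : ℤ) - m) * (n + m + 1) = 0 := by linear_combination this
    rcases mul_eq_zero.1 h2 with h3 | h3 <;> omega
  · simpa using hW

theorem integral_legendrePoly_mul_of_natDegree_lt {n : ℕ} {q : ℝ[X]} (hq : q.natDegree < n) :
    ∫ x in (-1 : ℝ)..1, (legendrePoly n * q).eval x = 0 := by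
  obtain ⟨k, rfl⟩ : ∃ k, n = k + 1 := ⟨n - 1, by omega⟩
  obtain ⟨c, rfl⟩ := exists_eq_sum_legendrePoly (Nat.lt_succ_iff.1 hq)
  simp only [Finset.mul_sum, eval_finsetSum]
  rw [intervalIntegral.integral_finsetSum fun i _ =>
    (Polynomial.continuous _).intervalIntegrable _ _]
  refine Finset.sum_eq_zero fun i hi => ?_
  have hi' : k + 1 ≠ i := by have := Finset.mem_range.1 hi; omega
  have := integral_legendrePoly_mul_of_ne hi'
  simp only [mul_left_comm _ (C (c i)), eval_C_mul, intervalIntegral.integral_const_mul, this,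
    mul_zero]

theorem integral_legendrePoly_sq (n : ℕ) :
    ∫ x in (-1 : ℝ)..1, (legendrePoly n * legendrePoly n).eval x = 2 / (2 * n + 1) := by
  have hlow : ∫ x in (-1 : ℝ)..1, (legendrePoly n *
      (X * derivative (legendrePoly n) - C (n : ℝ) * legendrePoly n)).eval x = 0 := by
    rcases Nat.eq_zero_or_pos n with rfl | hn
    · have : derivative (legendrePoly 0) = 0 :=
        derivative_of_natDegree_zero (natDegree_legendrePoly 0)
      simp [this]
    · apply integral_legendrePoly_mul_of_natDegree_lt
      obtain ⟨k, rfl⟩ : ∃ k, n = k + 1 := ⟨n - 1, by omega⟩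
      rw [Nat.lt_succ_iff, natDegree_le_iff_coeff_eq_zero]
      intro N hN
      obtain ⟨M, rfl⟩ : ∃ M, N = M + 1 := ⟨N - 1, by omega⟩
      rw [coeff_sub, coeff_C_mul, coeff_X_mul, coeff_derivative]
      rcases eq_or_lt_of_le (Nat.succ_le_of_lt hN) with h | h
      · have : M = k := by omega
        subst this
        push_cast; ring
      · rw [coeff_eq_zero_of_natDegree_lt (by rw [natDegree_legendrePoly]; omega)]
        simp
  have hW := integral_eval_derivative (X * (legendrePoly n * legendrePoly n)) (-1) 1
  have e : derivative (X * (legendrePoly n * legendrePoly n)) =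
      C (2 * (n : ℝ) + 1) * (legendrePoly n * legendrePoly n) + C 2 * (legendrePoly n *
      (X * derivative (legendrePoly n) - C (n : ℝ) * legendrePoly n)) := by
    simp only [derivative_mul, derivative_X, map_add, map_mul, map_one]
    have e : (C 2 : ℝ[X]) = 2 := rfl
    rw [e]; ring
  rw [e] at hW
  simp only [eval_add (p := C _ * _), eval_C_mul] at hW
  rw [intervalIntegral.integral_add
    ((by fun_prop : Continuous _).intervalIntegrable _ _)
    ((by fun_prop : Continuous _).intervalIntegrable _ _),
    intervalIntegral.integral_const_mul, intervalIntegral.integral_const_mul, hlow] at hW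
  simp only [eval_mul, eval_X, legendrePoly_eval_one, legendrePoly_eval_neg_one] at hW
  rw [← mul_pow] at hW
  simp only [eval_mul]
  rw [eq_div_iff (by positivity)]
  norm_num at hW
  linarith

/-- The primitive of the Legendre polynomial `P_n`, `n ≥ 1`, vanishing at `±1`. -/
noncomputable def legendrePrimitive (n : ℕ) : ℝ[X] :=
  C (-1 / ((n : ℝ) * (n + 1))) * ((1 - X ^ 2) * derivative (legendrePoly n))

theorem derivative_legendrePrimitive {n : ℕ} (hn : n ≠ 0) :
    derivative (legendrePrimitive n) = legendrePoly n := by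
  have : (n : ℝ) ≠ 0 := by exact_mod_cast hn
  rw [legendrePrimitive, derivative_mul, legendrePoly_ode, derivative_C, zero_mul, zero_add,
    ← mul_assoc, ← C_neg, ← C_mul]
  have e : -1 / ((n : ℝ) * (n + 1)) * -((n : ℝ) * (n + 1)) = 1 := by field_simp
  rw [e]; simp

theorem legendrePrimitive_eval_one (n : ℕ) : (legendrePrimitive n).eval 1 = 0 := by
  simp [legendrePrimitive]

theorem legendrePrimitive_eval_neg_one (n : ℕ) : (legendrePrimitive n).eval (-1) = 0 := by
  simp [legendrePrimitive]

theorem integral_legendrePrimitive_sq_le {n : ℕ} (hn : n ≠ 0) :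
    ∫ x in (-1 : ℝ)..1, (legendrePrimitive n).eval x ^ 2
      ≤ 2 / ((2 * n + 1) * (n * (n + 1))) := by
  have hn' : (0 : ℝ) < n := by exact_mod_cast Nat.pos_of_ne_zero hn
  have hW := integral_eval_derivative ((1 - X ^ 2) * derivative (legendrePoly n) * legendrePoly n)
    (-1) 1
  rw [derivative_mul, legendrePoly_ode, neg_mul, neg_mul, mul_assoc (C _)] at hW
  simp only [eval_add, eval_neg, eval_C_mul] at hW
  rw [intervalIntegral.integral_add
    ((by fun_prop : Continuous _).intervalIntegrable _ _)
    ((by fun_prop : Continuous _).intervalIntegrable _ _),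
    intervalIntegral.integral_neg, intervalIntegral.integral_const_mul,
    integral_legendrePoly_sq] at hW
  calc ∫ x in (-1 : ℝ)..1, (legendrePrimitive n).eval x ^ 2
      ≤ ∫ x in (-1 : ℝ)..1, (1 / ((n : ℝ) * (n + 1))) ^ 2 *
        ((1 - X ^ 2) * derivative (legendrePoly n) * derivative (legendrePoly n)).eval x := by
        apply intervalIntegral.integral_mono_on (by norm_num)
          ((by fun_prop : Continuous _).intervalIntegrable _ _)
          ((by fun_prop : Continuous _).intervalIntegrable _ _)
        intro x hx
        have h1 : 0 ≤ 1 - x ^ 2 := by nlinarith [hx.1, hx.2]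
        have h2 : 1 - x ^ 2 ≤ 1 := by nlinarith
        simp only [legendrePrimitive, eval_mul, eval_C, eval_sub, eval_one, eval_pow, eval_X]
        have h3 : 0 ≤ (1 / ((n : ℝ) * (n + 1))) ^ 2 * ((derivative (legendrePoly n)).eval x) ^ 2 := by
          positivity
        calc _ = ((1 / ((n : ℝ) * (n + 1))) ^ 2 * ((derivative (legendrePoly n)).eval x) ^ 2)
              * (1 - x ^ 2) * (1 - x ^ 2) := by ring
          _ ≤ ((1 / ((n : ℝ) * (n + 1))) ^ 2 * ((derivative (legendrePoly n)).eval x) ^ 2)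
              * (1 - x ^ 2) * 1 := by gcongr
          _ = _ := by ring
    _ = 2 / ((2 * n + 1) * (n * (n + 1))) := by
        rw [intervalIntegral.integral_const_mul]
        simp only [eval_mul, eval_sub, eval_one, eval_pow, eval_X] at hW ⊢
        norm_num at hW
        have : ∫ x in (-1 : ℝ)..1, (1 - x ^ 2) * eval x (derivative (legendrePoly n)) *
          eval x (derivative (legendrePoly n)) = (n : ℝ) * (n + 1) * (2 / (2 * n + 1)) := by
          linarith
        rw [this]
        field_simp

end LegendrePolynomials

section LegendreSystem

variable {t T : ℝ}

theorem continuous_legendreP (n : ℕ) : Continuous (legendreP n) := by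
  rw [funext (legendreP_eq_eval n)]
  exact (legendrePoly n).continuous

theorem continuous_legendreSys (t T : ℝ) (n : ℕ) : Continuous (legendreSys t T n) := by
  have := continuous_legendreP n
  unfold legendreSys
  fun_prop

theorem integral_comp_affine_Icc (ht : t < T) (f : ℝ → ℝ) :
    ∫ x in t..T, f ((2 * x - (T + t)) / (T - t)) = (T - t) / 2 * ∫ x in (-1 : ℝ)..1, f x := by
  have hd : T - t ≠ 0 := (sub_pos.2 ht).ne'
  have h := intervalIntegral.integral_comp_mul_sub (a := t) (b := T) f
    (c := 2 / (T - t)) (div_ne_zero two_ne_zero hd) ((T + t) / (T - t))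
  have e1 : 2 / (T - t) * t - (T + t) / (T - t) = -1 := by field_simp; ring
  have e2 : 2 / (T - t) * T - (T + t) / (T - t) = 1 := by field_simp; ring
  rw [e1, e2, inv_div, smul_eq_mul] at h
  rw [← h]
  congr 1
  ext x
  congr 1
  field_simp

theorem integral_legendreSys_mul (ht : t < T) (m n : ℕ) :
    ∫ x in t..T, legendreSys t T m x * legendreSys t T n x = if m = n then 1 else 0 := by
  have hd : 0 < T - t := sub_pos.2 ht
  have h := integral_comp_affine_Icc ht fun y => (legendrePoly m * legendrePoly n).eval y
  have e : ∀ x, legendreSys t T m x * legendreSys t T n x =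
      Real.sqrt ((2 * (m : ℝ) + 1) / (T - t)) * Real.sqrt ((2 * (n : ℝ) + 1) / (T - t)) *
      (legendrePoly m * legendrePoly n).eval ((2 * x - (T + t)) / (T - t)) := fun x => by
    simp only [legendreSys, legendreP_eq_eval, Polynomial.eval_mul]
    ring
  simp only [e, intervalIntegral.integral_const_mul, h]
  split_ifs with hmn
  · subst hmn
    rw [integral_legendrePoly_sq, Real.mul_self_sqrt (by positivity)]
    field_simp
  · rw [integral_legendrePoly_mul_of_ne hmn]
    simp

/-- The primitive of `legendreSys t T n`, `n ≥ 1`, vanishing at `t` and `T`. -/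
noncomputable def legendreSysPrimitive (t T : ℝ) (n : ℕ) (x : ℝ) : ℝ :=
  Real.sqrt ((2 * (n : ℝ) + 1) / (T - t)) * ((T - t) / 2) *
    (legendrePrimitive n).eval ((2 * x - (T + t)) / (T - t))

theorem hasDerivAt_legendreSysPrimitive (ht : t < T) {n : ℕ} (hn : n ≠ 0) (x : ℝ) :
    HasDerivAt (legendreSysPrimitive t T n) (legendreSys t T n x) x := by
  have hd : T - t ≠ 0 := (sub_pos.2 ht).ne'
  have h1 : HasDerivAt (fun x : ℝ => (2 * x - (T + t)) / (T - t)) (2 * 1 / (T - t)) x :=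
    (((hasDerivAt_id x).const_mul 2).sub_const _).div_const _
  have h2 := ((legendrePrimitive n).hasDerivAt ((2 * x - (T + t)) / (T - t))).comp x h1
  refine (h2.const_mul (Real.sqrt ((2 * (n : ℝ) + 1) / (T - t)) * ((T - t) / 2))).congr_deriv ?_
  rw [derivative_legendrePrimitive hn, legendreSys, legendreP_eq_eval]
  field_simp

theorem continuous_legendreSysPrimitive (t T : ℝ) (n : ℕ) :
    Continuous (legendreSysPrimitive t T n) := by
  unfold legendreSysPrimitive
  fun_prop

theorem legendreSysPrimitive_left (ht : t < T) (n : ℕ) : legendreSysPrimitive t T n t = 0 := by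
  have hd : T - t ≠ 0 := (sub_pos.2 ht).ne'
  have : (2 * t - (T + t)) / (T - t) = -1 := by field_simp; ring
  rw [legendreSysPrimitive, this, legendrePrimitive_eval_neg_one, mul_zero]

theorem legendreSysPrimitive_right (ht : t < T) (n : ℕ) : legendreSysPrimitive t T n T = 0 := by
  have hd : T - t ≠ 0 := (sub_pos.2 ht).ne'
  have : (2 * T - (T + t)) / (T - t) = 1 := by field_simp; ring
  rw [legendreSysPrimitive, this, legendrePrimitive_eval_one, mul_zero]

theorem integral_legendreSysPrimitive_sq_le (ht : t < T) {n : ℕ} (hn : n ≠ 0) :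
    ∫ x in t..T, legendreSysPrimitive t T n x ^ 2 ≤ (T - t) ^ 2 / 4 / (n * (n + 1)) := by
  have hd : 0 < T - t := sub_pos.2 ht
  have hn' : (0 : ℝ) < n := by exact_mod_cast Nat.pos_of_ne_zero hn
  have h := integral_comp_affine_Icc ht fun y => (legendrePrimitive n).eval y ^ 2
  simp only [legendreSysPrimitive, mul_pow, intervalIntegral.integral_const_mul, h]
  rw [Real.sq_sqrt (by positivity)]
  calc _ ≤ (2 * (n : ℝ) + 1) / (T - t) * ((T - t) / 2) ^ 2 * ((T - t) / 2 *
        (2 / ((2 * n + 1) * (n * (n + 1))))) := by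
        gcongr
        exact integral_legendrePrimitive_sq_le hn
    _ = _ := by field_simp; norm_num

theorem exists_pow_eq_sum_legendreSys (ht : t < T) (m : ℕ) :
    ∃ c : ℕ → ℝ, ∀ x : ℝ, x ^ m = ∑ i ∈ Finset.range (m + 1), c i * legendreSys t T i x := by
  have hd : 0 < T - t := sub_pos.2 ht
  obtain ⟨c, hc⟩ := exists_eq_sum_legendrePoly (m := m)
    (q := (Polynomial.C ((T - t) / 2) * Polynomial.X + Polynomial.C ((T + t) / 2)) ^ m) (by
      refine Polynomial.natDegree_pow_le.trans ?_
      calc m * _ ≤ m * 1 := by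
            gcongr
            exact Polynomial.natDegree_linear_le
        _ = m := mul_one m)
  refine ⟨fun i => c i / Real.sqrt ((2 * (i : ℝ) + 1) / (T - t)), fun x => ?_⟩
  have h := congrArg (Polynomial.eval ((2 * x - (T + t)) / (T - t))) hc
  simp only [Polynomial.eval_finsetSum, Polynomial.eval_mul, Polynomial.eval_C,
    Polynomial.eval_pow, Polynomial.eval_add, Polynomial.eval_X] at h
  have e : (T - t) / 2 * ((2 * x - (T + t)) / (T - t)) + (T + t) / 2 = x := by
    field_simp; ring
  rw [e] at h
  rw [h]
  refine Finset.sum_congr rfl fun i _ => ?_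
  have : Real.sqrt ((2 * (i : ℝ) + 1) / (T - t)) ≠ 0 := by positivity
  rw [legendreSys, legendreP_eq_eval]
  field_simp

end LegendreSystem

section TensorSystem

variable {t T : ℝ} {k : ℕ}

instance isFiniteMeasure_boxMeasure (t T : ℝ) (k : ℕ) : IsFiniteMeasure (boxMeasure t T k) := by
  unfold boxMeasure
  infer_instance

theorem boxMeasure_eq_restrict (t T : ℝ) (k : ℕ) :
    boxMeasure t T k = volume.restrict (Set.pi Set.univ fun _ => Set.Icc t T) := by
  rw [boxMeasure, volume_pi, Measure.restrict_pi_pi]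

theorem isCompact_box (t T : ℝ) (k : ℕ) :
    IsCompact (Set.pi Set.univ fun _ : Fin k => Set.Icc t T) :=
  isCompact_univ_pi fun _ => isCompact_Icc

theorem ae_boxMeasure_mem (t T : ℝ) (k : ℕ) :
    ∀ᵐ x ∂boxMeasure t T k, ∀ i, x i ∈ Set.Icc t T := by
  rw [boxMeasure_eq_restrict]
  filter_upwards [ae_restrict_mem (isCompact_box t T k).measurableSet] with x hx i
  exact hx i (Set.mem_univ i)

theorem memLp_boxMeasure_of_continuous {f : (Fin k → ℝ) → ℝ} (hf : Continuous f) (p : ENNReal) :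
    MemLp f p (boxMeasure t T k) := by
  obtain ⟨C, hC⟩ := (isCompact_box t T k).exists_bound_of_continuousOn hf.continuousOn
  refine MemLp.of_bound hf.aestronglyMeasurable C ?_
  filter_upwards [ae_boxMeasure_mem t T k] with x hx
  exact hC x fun i _ => hx i

theorem inner_toLp_eq_integral {α : Type*} [MeasurableSpace α] {μ : Measure α} {f g : α → ℝ}
    (hf : MemLp f 2 μ) (hg : MemLp g 2 μ) :
    inner ℝ (hf.toLp f) (hg.toLp g) = ∫ x, f x * g x ∂μ := by
  rw [L2.inner_def]
  refine integral_congr_ae ?_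
  filter_upwards [hf.coeFn_toLp, hg.coeFn_toLp] with x h1 h2
  simp [h1, h2, mul_comm]

theorem integral_restrict_Icc (ht : t ≤ T) (f : ℝ → ℝ) :
    ∫ x in Set.Icc t T, f x = ∫ x in t..T, f x := by
  rw [intervalIntegral.integral_of_le ht, integral_Icc_eq_integral_Ioc]

/-- The tensor product `φ_{j₁} ⊗ ⋯ ⊗ φ_{j_k}` of normalized Legendre functions. -/
noncomputable def legendreTensor (t T : ℝ) (j : Fin k → ℕ) (x : Fin k → ℝ) : ℝ :=
  ∏ l, legendreSys t T (j l) (x l)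

theorem continuous_legendreTensor (t T : ℝ) (j : Fin k → ℕ) :
    Continuous (legendreTensor t T j) :=
  continuous_finsetProd _ fun l _ => (continuous_legendreSys t T (j l)).comp (continuous_apply l)

/-- The tensor Legendre function as an element of `L²([t,T]^k)`. -/
noncomputable def legendreTensorLp (t T : ℝ) (j : Fin k → ℕ) : Lp ℝ 2 (boxMeasure t T k) :=
  (memLp_boxMeasure_of_continuous (continuous_legendreTensor t T j) 2).toLp _

theorem orthonormal_legendreTensorLp (ht : t < T) :
    Orthonormal ℝ (legendreTensorLp t T : (Fin k → ℕ) → _) := by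
  rw [orthonormal_iff_ite]
  intro i j
  rw [legendreTensorLp, legendreTensorLp, inner_toLp_eq_integral]
  simp only [legendreTensor, ← Finset.prod_mul_distrib]
  rw [boxMeasure, integral_fintype_prod_eq_prod (𝕜 := ℝ)
    (fun l y => legendreSys t T (i l) y * legendreSys t T (j l) y)]
  simp only [integral_restrict_Icc ht.le, integral_legendreSys_mul ht]
  rw [Finset.prod_ite_zero]
  simp [funext_iff]

theorem exists_monomial_eq_sum_legendreTensor (ht : t < T) (m : Fin k →₀ ℕ) :
    ∃ (s : Finset (Fin k → ℕ)) (c : (Fin k → ℕ) → ℝ), ∀ x : Fin k → ℝ,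
      ∏ l, x l ^ m l = ∑ j ∈ s, c j * legendreTensor t T j x := by
  choose c hc using exists_pow_eq_sum_legendreSys ht
  refine ⟨Fintype.piFinset fun l => Finset.range (m l + 1), fun j => ∏ l, c (m l) (j l),
    fun x => ?_⟩
  simp only [hc, Finset.prod_univ_sum, legendreTensor, Finset.prod_mul_distrib]

theorem inner_toLp_mvPolynomial_eq_zero (ht : t < T) {f : Lp ℝ 2 (boxMeasure t T k)}
    (hf : ∀ j, inner ℝ (legendreTensorLp t T j) f = 0) (q : MvPolynomial (Fin k) ℝ) :
    ∫ x, MvPolynomial.eval x q * f x ∂boxMeasure t T k = 0 := by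
  have hint : ∀ g : (Fin k → ℝ) → ℝ, Continuous g →
      Integrable (fun x => g x * f x) (boxMeasure t T k) := fun g hg =>
    (memLp_boxMeasure_of_continuous hg 2).integrable_mul (Lp.memLp f)
  have hj : ∀ j, ∫ x, legendreTensor t T j x * f x ∂boxMeasure t T k = 0 := fun j => by
    have := hf j
    rw [legendreTensorLp, ← Lp.toLp_coeFn f (Lp.memLp f), inner_toLp_eq_integral] at this
    exact this
  have hcont : ∀ m : Fin k →₀ ℕ, Continuous fun x : Fin k → ℝ => ∏ l, x l ^ m l := fun m => by
    fun_prop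
  have hm : ∀ m : Fin k →₀ ℕ, ∫ x, (∏ l, x l ^ m l) * f x ∂boxMeasure t T k = 0 := fun m => by
    obtain ⟨s, c, hc⟩ := exists_monomial_eq_sum_legendreTensor ht m
    simp only [hc, Finset.sum_mul, mul_assoc]
    rw [integral_finsetSum _ fun j _ => (hint _ (continuous_legendreTensor t T j)).const_mul _]
    simp [integral_const_mul, hj]
  simp only [MvPolynomial.eval_eq', Finset.sum_mul, mul_assoc]
  rw [integral_finsetSum _ fun m _ => (hint _ (hcont m)).const_mul _]
  simp [integral_const_mul, hm]

theorem exists_mvPolynomial_near {s : Set (Fin k → ℝ)} (hs : IsCompact s)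
    {g : (Fin k → ℝ) → ℝ} (hg : Continuous g) {ε : ℝ} (hε : 0 < ε) :
    ∃ q : MvPolynomial (Fin k) ℝ, ∀ x ∈ s, |g x - MvPolynomial.eval x q| < ε := by
  have : CompactSpace s := isCompact_iff_compactSpace.1 hs
  let X : Fin k → C(s, ℝ) := fun l => ⟨fun x => (x : Fin k → ℝ) l, (continuous_apply l).comp continuous_subtype_val⟩
  have hX : ∀ (q : MvPolynomial (Fin k) ℝ) (x : s),
      (MvPolynomial.aeval X q) x = MvPolynomial.eval (x : Fin k → ℝ) q := fun q x => by
    induction q using MvPolynomial.induction_on with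
    | C a => simp
    | add p q hp hq => simp [hp, hq]
    | mul_X p i hp => simp [hp, X]
  have hsep : (MvPolynomial.aeval (R := ℝ) X).range.SeparatesPoints := by
    intro x y hxy
    obtain ⟨l, hl⟩ := Function.ne_iff.1 (Subtype.coe_injective.ne hxy)
    exact ⟨X l, ⟨X l, ⟨MvPolynomial.X l, by simp⟩, rfl⟩, hl⟩
  obtain ⟨⟨_, q, rfl⟩, hq⟩ :=
    ContinuousMap.exists_mem_subalgebra_near_continuousMap_of_separatesPoints _ hsep
      ⟨fun x => g x, by fun_prop⟩ ε hε
  refine ⟨q, fun x hx => ?_⟩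
  have := (ContinuousMap.norm_lt_iff _ hε).1 hq ⟨x, hx⟩
  rw [abs_sub_comm]
  simpa [hX] using this

theorem eq_zero_of_inner_legendreTensorLp_eq_zero (ht : t < T) {f : Lp ℝ 2 (boxMeasure t T k)}
    (hf : ∀ j, inner ℝ (legendreTensorLp t T j) f = 0) : f = 0 := by
  have : (boxMeasure t T k).WeaklyRegular := by
    rw [boxMeasure_eq_restrict]; infer_instance
  have hd := BoundedContinuousFunction.toLp_denseRange ℝ (boxMeasure t T k) ℝ
    (p := 2) (by norm_num)
  have hzero : ∀ g : Lp ℝ 2 (boxMeasure t T k), inner ℝ g f = 0 := by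
    intro g
    refine hd.induction_on (p := fun g => inner ℝ g f = 0) g
      (isClosed_eq (by fun_prop) continuous_const) fun g => ?_
    have hI : inner ℝ (BoundedContinuousFunction.toLp 2 (boxMeasure t T k) ℝ g) f
        = ∫ x, g x * f x ∂boxMeasure t T k := by
      rw [L2.inner_def]
      refine integral_congr_ae ?_
      filter_upwards [BoundedContinuousFunction.coeFn_toLp (p := 2) (boxMeasure t T k) ℝ g]
        with x h1
      simp [h1, mul_comm]
    have hint : ∀ g : (Fin k → ℝ) → ℝ, Continuous g →
        Integrable (fun x => g x * f x) (boxMeasure t T k) := fun g hg =>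
      (memLp_boxMeasure_of_continuous hg 2).integrable_mul (Lp.memLp f)
    have hfint : Integrable (fun x => |f x|) (boxMeasure t T k) :=
      ((Lp.memLp f).integrable (by norm_num)).abs
    change inner ℝ (BoundedContinuousFunction.toLp 2 (boxMeasure t T k) ℝ g) f = 0
    rw [hI, ← abs_nonpos_iff]
    refine le_of_forall_pos_le_add fun δ hδ => ?_
    set A := ∫ x, |f x| ∂boxMeasure t T k with hA
    have hA0 : 0 ≤ A := integral_nonneg fun x => abs_nonneg _
    obtain ⟨q, hq⟩ := exists_mvPolynomial_near (isCompact_box t T k) g.continuous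
      (show 0 < δ / (A + 1) by positivity)
    have hqc : Continuous fun x : Fin k → ℝ => MvPolynomial.eval x q :=
      MvPolynomial.continuous_eval q
    have hsub : ∫ x, g x * f x ∂boxMeasure t T k =
        ∫ x, (g x - MvPolynomial.eval x q) * f x ∂boxMeasure t T k := by
      simp only [sub_mul]
      rw [integral_sub (hint _ g.continuous) (hint _ hqc),
        inner_toLp_mvPolynomial_eq_zero ht hf q, sub_zero]
    rw [hsub, zero_add]
    calc |∫ x, (g x - MvPolynomial.eval x q) * f x ∂boxMeasure t T k|
        ≤ ∫ x, δ / (A + 1) * |f x| ∂boxMeasure t T k := by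
          rw [← Real.norm_eq_abs]
          refine norm_integral_le_of_norm_le (hfint.const_mul _) ?_
          filter_upwards [ae_boxMeasure_mem t T k] with x hx
          rw [norm_mul, Real.norm_eq_abs, Real.norm_eq_abs]
          gcongr
          exact (hq x fun i _ => hx i).le
      _ = δ / (A + 1) * A := by rw [integral_const_mul]
      _ ≤ δ := by
          rw [div_mul_eq_mul_div, div_le_iff₀ (by positivity)]
          nlinarith
  exact inner_self_eq_zero.1 (hzero f)

theorem hasSum_sq_integral_mul_legendreTensor (ht : t < T) {f : (Fin k → ℝ) → ℝ}
    (hf : MemLp f 2 (boxMeasure t T k)) :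
    HasSum (fun j : Fin k → ℕ => (∫ x, f x * legendreTensor t T j x ∂boxMeasure t T k) ^ 2)
      (∫ x, f x ^ 2 ∂boxMeasure t T k) := by
  let b := HilbertBasis.mkOfOrthogonalEqBot (𝕜 := ℝ) (orthonormal_legendreTensorLp (k := k) ht) (by
    rw [Submodule.eq_bot_iff]
    intro g hg
    exact eq_zero_of_inner_legendreTensorLp_eq_zero ht fun j =>
      hg _ (Submodule.subset_span ⟨j, rfl⟩))
  have hb : ∀ j, b j = legendreTensorLp t T j := fun j => by
    simp [b]
  have h := b.hasSum_inner_mul_inner (hf.toLp f) (hf.toLp f)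
  rw [inner_toLp_eq_integral] at h
  simp only [hb, real_inner_comm (hf.toLp f)] at h
  simp only [legendreTensorLp, inner_toLp_eq_integral, ← pow_two] at h
  exact h

/-- Bessel's inequality for the tensor Legendre system. -/
theorem sum_sq_integral_mul_legendreTensor_le (ht : t < T) {f : (Fin k → ℝ) → ℝ}
    (hf : MemLp f 2 (boxMeasure t T k)) (s : Finset (Fin k → ℕ)) :
    ∑ j ∈ s, (∫ x, f x * legendreTensor t T j x ∂boxMeasure t T k) ^ 2
      ≤ ∫ x, f x ^ 2 ∂boxMeasure t T k :=
  sum_le_hasSum s (fun _ _ => sq_nonneg _) (hasSum_sq_integral_mul_legendreTensor ht hf)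

end TensorSystem

section Slices

variable {t T : ℝ} {k : ℕ}

theorem measurableSet_strictMono (k : ℕ) : MeasurableSet {x : Fin k → ℝ | StrictMono x} := by
  simp only [StrictMono, Set.ofPred_forall]
  exact MeasurableSet.iInter fun i => MeasurableSet.iInter fun j => MeasurableSet.iInter fun _ =>
    measurableSet_lt (measurable_pi_apply i) (measurable_pi_apply j)

theorem integral_boxMeasure_succ (l : Fin (k + 1)) (F : (Fin (k + 1) → ℝ) → ℝ) :
    ∫ x, F x ∂boxMeasure t T (k + 1) =
      ∫ z : ℝ × (Fin k → ℝ), F (l.insertNth z.1 z.2)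
        ∂((volume.restrict (Set.Icc t T)).prod (boxMeasure t T k)) := by
  have h := (measurePreserving_piFinSuccAbove (α := fun _ : Fin (k + 1) => ℝ)
    (fun _ => volume.restrict (Set.Icc t T)) l).symm
  rw [boxMeasure, boxMeasure, ← h.integral_comp (MeasurableEquiv.measurableEmbedding _)]
  rfl

theorem integrable_boxMeasure_succ (l : Fin (k + 1)) {F : (Fin (k + 1) → ℝ) → ℝ}
    (hF : Integrable F (boxMeasure t T (k + 1))) :
    Integrable (fun z : ℝ × (Fin k → ℝ) => F (l.insertNth z.1 z.2))
      ((volume.restrict (Set.Icc t T)).prod (boxMeasure t T k)) := by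
  have h := (measurePreserving_piFinSuccAbove (α := fun _ : Fin (k + 1) => ℝ)
    (fun _ => volume.restrict (Set.Icc t T)) l).symm
  exact (h.integrable_comp_emb (MeasurableEquiv.measurableEmbedding _)).2 hF

theorem strictMono_snoc_and_lt_iff (y : Fin k → ℝ) (u s : ℝ) :
    (StrictMono (Fin.snoc y u : Fin (k + 1) → ℝ) ∧
      ∀ i, (Fin.snoc y u : Fin (k + 1) → ℝ) i < s) ↔
      (StrictMono y ∧ ∀ i, y i < u) ∧ u < s := by
  constructor
  · rintro ⟨h1, h2⟩
    refine ⟨⟨fun i j hij => ?_, fun i => ?_⟩, by simpa using h2 (Fin.last k)⟩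
    · simpa using h1 (Fin.castSucc_lt_castSucc_iff.2 hij)
    · simpa using h1 (Fin.castSucc_lt_last i)
  · rintro ⟨⟨h1, h2⟩, h3⟩
    refine ⟨fun i j => ?_, fun i => ?_⟩
    · refine Fin.lastCases ?_ (fun j => ?_) j
      · refine Fin.lastCases ?_ (fun i => ?_) i
        · simp
        · simpa using fun _ : i.castSucc < Fin.last k => h2 i
      · refine Fin.lastCases ?_ (fun i => ?_) i
        · intro h
          exact absurd h (Fin.castSucc_lt_last j).not_gt
        · simpa using fun h => h1 h
    · refine Fin.lastCases ?_ (fun i => ?_) i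
      · simpa using h3
      · simpa using (h2 i).trans h3

open Classical in
theorem simplexIntegral_eq_integral_boxMeasure (f g : Fin k → ℝ → ℝ)
    (hg : ∀ l, Continuous (g l)) (hfg : ∀ l, ∀ x ∈ Set.Icc t T, f l x = g l x)
    {s : ℝ} (hs : s ∈ Set.Icc t T) :
    simplexIntegral t (List.ofFn f).reverse s =
      ∫ x, (if StrictMono x ∧ ∀ i, x i < s then ∏ l, g l (x l) else 0) ∂boxMeasure t T k := by
  induction k generalizing s with
  | zero =>
    have : (Measure.pi fun _ : Fin 0 => volume.restrict (Set.Icc t T)).real Set.univ = 1 := by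
      rw [measureReal_def, Measure.pi_univ]
      simp
    simp [simplexIntegral, boxMeasure, Subsingleton.strictMono, this]
  | succ k ih =>
    have hint : Integrable (fun x : Fin (k + 1) → ℝ =>
        if StrictMono x ∧ ∀ i, x i < s then ∏ l, g l (x l) else 0)
        (boxMeasure t T (k + 1)) := by
      have hc : Continuous fun x : Fin (k + 1) → ℝ => ∏ l, g l (x l) :=
        continuous_finsetProd _ fun l _ => (hg l).comp (continuous_apply l)
      have hm : MeasurableSet {x : Fin (k + 1) → ℝ | StrictMono x ∧ ∀ i, x i < s} := by
        have h : MeasurableSet {x : Fin (k + 1) → ℝ | ∀ i, x i < s} := by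
          simp only [Set.ofPred_forall]
          exact MeasurableSet.iInter fun i => measurableSet_lt (measurable_pi_apply i)
            measurable_const
        exact (measurableSet_strictMono _).inter h
      refine (((memLp_boxMeasure_of_continuous hc 1).integrable le_rfl).indicator hm).congr
        (ae_of_all _ fun x => ?_)
      simp only [Set.indicator, Set.mem_ofPred_eq]
    rw [integral_boxMeasure_succ (Fin.last k),
      integral_prod _ (integrable_boxMeasure_succ (Fin.last k) hint), List.ofFn_succ',
      List.concat_eq_append, List.reverse_append, List.reverse_singleton, List.singleton_append,
      simplexIntegral]
    simp only [Fin.insertNth_last', strictMono_snoc_and_lt_iff, Fin.prod_univ_castSucc,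
      Fin.snoc_castSucc, Fin.snoc_last]
    rw [intervalIntegral.integral_of_le hs.1, ← integral_indicator measurableSet_Ioc,
      ← integral_indicator measurableSet_Icc]
    refine integral_congr_ae ?_
    filter_upwards [compl_mem_ae_iff.2 (measure_singleton (μ := (volume : Measure ℝ)) t),
      compl_mem_ae_iff.2 (measure_singleton (μ := (volume : Measure ℝ)) s)] with u h1 h2
    simp only [Set.mem_compl_iff, Set.mem_singleton_iff] at h1 h2
    simp only [Set.indicator, Set.mem_Ioc]
    by_cases hu : u ∈ Set.Icc t T
    · by_cases hus : u < s
      · rw [if_pos ⟨lt_of_le_of_ne hu.1 (Ne.symm h1), hus.le⟩, if_pos hu,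
          ih (fun i => f i.castSucc) (fun i => g i.castSucc) (fun l => hg _)
            (fun l => hfg l.castSucc) hu, hfg _ _ hu, ← integral_const_mul]
        simp only [hus, and_true, mul_ite, mul_zero, mul_comm]
      · rw [if_neg (fun h => hus (lt_of_le_of_ne h.2 h2)), if_pos hu]
        simp [hus]
    · rw [if_neg (fun h => hu ⟨h.1.le, h.2.trans hs.2⟩), if_neg hu]

end Slices

section OneDimensional

variable {t T : ℝ}

theorem exists_contDiff_extension (ht : t < T) {f : ℝ → ℝ} (hf : ContDiffOn ℝ 1 f (Set.Icc t T)) :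
    ∃ g g' : ℝ → ℝ, Continuous g' ∧ (∀ x, HasDerivAt g (g' x) x) ∧
      ∀ x ∈ Set.Icc t T, f x = g x := by
  have hD : ContinuousOn (derivWithin f (Set.Icc t T)) (Set.Icc t T) :=
    hf.continuousOn_derivWithin (uniqueDiffOn_Icc ht) le_rfl
  let g' : ℝ → ℝ := Set.IccExtend ht.le ((Set.Icc t T).domRestrict (derivWithin f (Set.Icc t T)))
  have hg' : Continuous g' := (continuousOn_iff_continuous_domRestrict.1 hD).Icc_extend'
  refine ⟨fun x => f t + ∫ y in t..x, g' y, g', hg', fun x => ?_, fun x hx => ?_⟩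
  · exact (hg'.integral_hasStrictDerivAt t x).hasDerivAt.const_add _
  · have h := intervalIntegral.integral_eq_sub_of_hasDerivAt_of_le (f := f) (f' := g') hx.1
      (hf.continuousOn.mono (Set.Icc_subset_Icc_right hx.2)) (fun y hy => ?_)
      (hg'.intervalIntegrable _ _)
    · show f x = f t + ∫ y in t..x, g' y
      rw [h]; ring
    · have hy' : y ∈ Set.Ioo t T := ⟨hy.1, hy.2.trans_le hx.2⟩
      have h1 := (hf.differentiableOn one_ne_zero y (Set.Ioo_subset_Icc_self hy')).hasDerivWithinAt
      have h2 : g' y = derivWithin f (Set.Icc t T) y :=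
        Set.IccExtend_of_mem _ _ (Set.Ioo_subset_Icc_self hy')
      rw [h2]
      exact h1.hasDerivAt (Icc_mem_nhds hy'.1 hy'.2)

theorem abs_integral_mul_legendreSys_le (ht : t < T) {g g' : ℝ → ℝ} (hg' : Continuous g')
    (hg : ∀ x, HasDerivAt g (g' x) x) {M : ℝ} (hM : ∀ x ∈ Set.Icc t T, |g x| ≤ M)
    (hM' : ∀ x ∈ Set.Icc t T, |g' x| ≤ M) {n : ℕ} (hn : n ≠ 0) {a b : ℝ}
    (ha : a ∈ Set.Icc t T) (hb : b ∈ Set.Icc t T) (hab : a ≤ b) :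
    |∫ x in a..b, g x * legendreSys t T n x| ≤
      M * (|legendreSysPrimitive t T n a| + |legendreSysPrimitive t T n b| +
        ∫ x in t..T, |legendreSysPrimitive t T n x|) := by
  have hΦ := continuous_legendreSysPrimitive t T n
  have hM0 : 0 ≤ M := (abs_nonneg _).trans (hM a ha)
  rw [intervalIntegral.integral_mul_deriv_eq_deriv_mul (fun x _ => hg x)
    (fun x _ => hasDerivAt_legendreSysPrimitive ht hn x) (hg'.intervalIntegrable _ _)
    ((continuous_legendreSys t T n).intervalIntegrable _ _)]
  have h1 : |g b * legendreSysPrimitive t T n b| ≤ M * |legendreSysPrimitive t T n b| := by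
    rw [abs_mul]; gcongr; exact hM b hb
  have h2 : |g a * legendreSysPrimitive t T n a| ≤ M * |legendreSysPrimitive t T n a| := by
    rw [abs_mul]; gcongr; exact hM a ha
  have h3 : |∫ x in a..b, g' x * legendreSysPrimitive t T n x| ≤
      M * ∫ x in t..T, |legendreSysPrimitive t T n x| := by
    calc |∫ x in a..b, g' x * legendreSysPrimitive t T n x|
        ≤ ∫ x in a..b, M * |legendreSysPrimitive t T n x| := by
          rw [← Real.norm_eq_abs]
          refine intervalIntegral.norm_integral_le_of_norm_le hab ?_
            ((by fun_prop : Continuous _).intervalIntegrable _ _)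
          refine ae_of_all _ fun x hx => ?_
          rw [norm_mul, Real.norm_eq_abs, Real.norm_eq_abs]
          gcongr
          exact hM' x ⟨ha.1.trans hx.1.le, hx.2.trans hb.2⟩
      _ = M * ∫ x in a..b, |legendreSysPrimitive t T n x| :=
          intervalIntegral.integral_const_mul _ _
      _ ≤ _ := by
          gcongr
          exact intervalIntegral.integral_mono_interval ha.1 hab hb.2
            (ae_of_all _ fun x => abs_nonneg _)
            ((by fun_prop : Continuous _).intervalIntegrable _ _)
  have h4 := abs_sub (g b * legendreSysPrimitive t T n b - g a * legendreSysPrimitive t T n a)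
    (∫ x in a..b, g' x * legendreSysPrimitive t T n x)
  have h5 := abs_sub (g b * legendreSysPrimitive t T n b) (g a * legendreSysPrimitive t T n a)
  linarith

theorem sq_integral_abs_le (ht : t < T) {f : ℝ → ℝ} (hf : Continuous f) :
    (∫ x in t..T, |f x|) ^ 2 ≤ (T - t) * ∫ x in t..T, f x ^ 2 := by
  have hd : 0 < T - t := sub_pos.2 ht
  set I := ∫ x in t..T, |f x| with hI
  set m := I / (T - t) with hm
  have h : 0 ≤ ∫ x in t..T, (|f x| - m) ^ 2 :=
    intervalIntegral.integral_nonneg ht.le fun x _ => sq_nonneg _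
  have e : ∀ x, (|f x| - m) ^ 2 = f x ^ 2 - 2 * m * |f x| + m ^ 2 := fun x => by
    rw [sub_sq, sq_abs]; ring
  simp only [e] at h
  rw [intervalIntegral.integral_add ((by fun_prop : Continuous _).intervalIntegrable _ _)
    ((by fun_prop : Continuous _).intervalIntegrable _ _),
    intervalIntegral.integral_sub ((by fun_prop : Continuous _).intervalIntegrable _ _)
    ((by fun_prop : Continuous _).intervalIntegrable _ _),
    intervalIntegral.integral_const_mul, intervalIntegral.integral_const, ← hI, smul_eq_mul] at h
  have hmI : m * (T - t) = I := by rw [hm]; field_simp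
  have : (T - t) * ((∫ x in t..T, f x ^ 2) - 2 * m * I + (T - t) * m ^ 2) ≥ 0 := by positivity
  nlinarith

theorem abs_integral_ite_mul_legendreSys_le (ht : t < T) {g g' : ℝ → ℝ} (hg' : Continuous g')
    (hg : ∀ x, HasDerivAt g (g' x) x) {M : ℝ} (hM : ∀ x ∈ Set.Icc t T, |g x| ≤ M)
    (hM' : ∀ x ∈ Set.Icc t T, |g' x| ≤ M) {n : ℕ} (hn : n ≠ 0) {a b : ℝ}
    (ha : a ∈ Set.Icc t T) (hb : b ∈ Set.Icc t T) {p : ℝ → Prop} [DecidablePred p]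
    (hp : ∀ x ∈ Set.Ioo t T, p x ↔ a < x ∧ x < b) :
    |∫ x in Set.Icc t T, if p x then g x * legendreSys t T n x else 0| ≤
      M * (|legendreSysPrimitive t T n a| + |legendreSysPrimitive t T n b| +
        ∫ x in t..T, |legendreSysPrimitive t T n x|) := by
  have hM0 : 0 ≤ M := (abs_nonneg _).trans (hM a ha)
  have e : ∫ x in Set.Icc t T, (if p x then g x * legendreSys t T n x else 0) =
      ∫ x in Set.Ioo a b, g x * legendreSys t T n x := by
    rw [integral_Icc_eq_integral_Ioo, ← integral_indicator measurableSet_Ioo,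
      ← integral_indicator measurableSet_Ioo]
    congr 1
    ext x
    by_cases hx : x ∈ Set.Ioo t T
    · rw [Set.indicator_of_mem hx]
      simp only [hp x hx, Set.indicator, Set.mem_Ioo]
    · rw [Set.indicator_of_notMem hx, Set.indicator_of_notMem]
      exact fun h => hx ⟨ha.1.trans_lt h.1, h.2.trans_le hb.2⟩
  rw [e]
  rcases le_total a b with hab | hab
  · rw [← integral_Ioc_eq_integral_Ioo, ← intervalIntegral.integral_of_le hab]
    exact abs_integral_mul_legendreSys_le ht hg' hg hM hM' hn ha hb hab
  · have : 0 ≤ ∫ x in t..T, |legendreSysPrimitive t T n x| :=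
      intervalIntegral.integral_nonneg ht.le fun x _ => abs_nonneg _
    rw [Set.Ioo_eq_empty hab.not_gt]
    simp only [Measure.restrict_empty, integral_zero_measure, abs_zero]
    positivity

end OneDimensional

section Kernel

variable {t T : ℝ} {k : ℕ}

theorem strictMono_insertNth_iff {y : Fin k → ℝ} (hy : StrictMono y) (l : Fin (k + 1)) (x : ℝ) :
    StrictMono (l.insertNth x y : Fin (k + 1) → ℝ) ↔
      (∀ i, i.castSucc < l → y i < x) ∧ ∀ i, l ≤ i.castSucc → x < y i := by
  constructor
  · refine fun h => ⟨fun i hi => ?_, fun i hi => ?_⟩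
    · have := h ((Fin.succAbove_of_castSucc_lt l i hi).trans_lt hi)
      simpa using this
    · have := h (Fin.lt_succAbove_iff_le_castSucc l i |>.2 hi)
      simpa using this
  · rintro ⟨h1, h2⟩ i j
    refine Fin.succAboveCases l ?_ (fun i => ?_) i
    · refine Fin.succAboveCases l ?_ (fun j => ?_) j
      · simp
      · simpa [Fin.lt_succAbove_iff_le_castSucc] using h2 j
    · refine Fin.succAboveCases l ?_ (fun j => ?_) j
      · simpa [Fin.succAbove_lt_iff_castSucc_lt] using h1 i
      · simpa using fun h => hy h

theorem strictMono_of_strictMono_insertNth {y : Fin k → ℝ} {l : Fin (k + 1)} {x : ℝ}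
    (h : StrictMono (l.insertNth x y : Fin (k + 1) → ℝ)) : StrictMono y := fun i j hij => by
  simpa using h (Fin.strictMono_succAbove l hij)

theorem exists_forall_lt_iff_lt (ht : t < T) {y : Fin k → ℝ} (hy : ∀ i, y i ∈ Set.Icc t T)
    (s : Finset (Fin k)) :
    ∃ a ∈ Set.Icc t T, (a = t ∨ ∃ i, a = y i) ∧ ∀ x, t < x → ((∀ i ∈ s, y i < x) ↔ a < x) := by
  induction s using Finset.induction with
  | empty => exact ⟨t, ⟨le_rfl, ht.le⟩, Or.inl rfl, by simp⟩
  | insert i s _ ih =>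
    obtain ⟨a, ha, ha', h⟩ := ih
    refine ⟨max a (y i), ⟨ha.1.trans (le_max_left _ _), max_le ha.2 (hy i).2⟩, ?_, fun x hx => ?_⟩
    · rcases max_choice a (y i) with h | h
      · rwa [h]
      · exact Or.inr ⟨i, h⟩
    · rw [Finset.forall_mem_insert, h x hx, max_lt_iff, and_comm]

theorem exists_forall_gt_iff_gt (ht : t < T) {y : Fin k → ℝ} (hy : ∀ i, y i ∈ Set.Icc t T)
    (s : Finset (Fin k)) :
    ∃ b ∈ Set.Icc t T, (b = T ∨ ∃ i, b = y i) ∧ ∀ x, x < T → ((∀ i ∈ s, x < y i) ↔ x < b) := by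
  induction s using Finset.induction with
  | empty => exact ⟨T, ⟨ht.le, le_rfl⟩, Or.inl rfl, by simp⟩
  | insert i s _ ih =>
    obtain ⟨b, hb, hb', h⟩ := ih
    refine ⟨min b (y i), ⟨le_min hb.1 (hy i).1, (min_le_left _ _).trans hb.2⟩, ?_, fun x hx => ?_⟩
    · rcases min_choice b (y i) with h | h
      · rwa [h]
      · exact Or.inr ⟨i, h⟩
    · rw [Finset.forall_mem_insert, h x hx, lt_min_iff, and_comm]

theorem measurable_kernelK {g : Fin k → ℝ → ℝ} (hg : ∀ l, Continuous (g l)) :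
    Measurable (kernelK g) :=
  Measurable.ite (measurableSet_strictMono k)
    (continuous_finsetProd _ fun l _ => (hg l).comp (continuous_apply l)).measurable
    measurable_const

theorem memLp_kernelK {g : Fin k → ℝ → ℝ} (hg : ∀ l, Continuous (g l)) :
    MemLp (kernelK g) 2 (boxMeasure t T k) := by
  refine ((memLp_boxMeasure_of_continuous (t := t) (T := T)
    (continuous_finsetProd Finset.univ fun l _ => (hg l).comp (continuous_apply l)) 2).indicator
    (measurableSet_strictMono k)).ae_eq (ae_of_all _ fun x => ?_)
  simp [Set.indicator, kernelK]

/-- The Legendre coefficient of index `n` of `F` in the `l`-th variable, as a function of the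
remaining variables. -/
noncomputable def sliceCoef (t T : ℝ) (F : (Fin (k + 1) → ℝ) → ℝ) (l : Fin (k + 1)) (n : ℕ)
    (y : Fin k → ℝ) : ℝ :=
  ∫ x in Set.Icc t T, F (l.insertNth x y) * legendreSys t T n x

theorem aestronglyMeasurable_sliceCoef {F : (Fin (k + 1) → ℝ) → ℝ} (hF : Measurable F)
    (l : Fin (k + 1)) (n : ℕ) :
    AEStronglyMeasurable (sliceCoef t T F l n) (boxMeasure t T k) := by
  have h : Measurable fun z : (Fin k → ℝ) × ℝ =>
      F (l.insertNth z.2 z.1) * legendreSys t T n z.2 := by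
    refine (hF.comp ?_).mul ((continuous_legendreSys t T n).measurable.comp measurable_snd)
    exact (MeasurableEquiv.piFinSuccAbove (fun _ => ℝ) l).symm.measurable.comp measurable_swap
  exact h.stronglyMeasurable.integral_prod_right.aestronglyMeasurable

theorem sq_sliceCoef_kernelK_le (ht : t < T) {g g' : Fin (k + 1) → ℝ → ℝ}
    (hg' : ∀ l, Continuous (g' l)) (hg : ∀ l x, HasDerivAt (g l) (g' l x) x) {M : ℝ}
    (hM : ∀ l, ∀ x ∈ Set.Icc t T, |g l x| ≤ M) (hM' : ∀ l, ∀ x ∈ Set.Icc t T, |g' l x| ≤ M)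
    (l : Fin (k + 1)) {n : ℕ} (hn : n ≠ 0) {y : Fin k → ℝ} (hy : ∀ i, y i ∈ Set.Icc t T) :
    sliceCoef t T (kernelK g) l n y ^ 2 ≤ (M ^ (k + 1)) ^ 2 * (3 *
      (2 * ∑ i, legendreSysPrimitive t T n (y i) ^ 2 +
        (T - t) * ∫ x in t..T, legendreSysPrimitive t T n x ^ 2)) := by
  have hJ : 0 ≤ (T - t) * ∫ x in t..T, legendreSysPrimitive t T n x ^ 2 :=
    mul_nonneg (sub_nonneg.2 ht.le)
      (intervalIntegral.integral_nonneg ht.le fun x _ => sq_nonneg _)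
  have hS : 0 ≤ ∑ i, legendreSysPrimitive t T n (y i) ^ 2 :=
    Finset.sum_nonneg fun i _ => sq_nonneg _
  have hM0 : 0 ≤ M := (abs_nonneg _).trans (hM 0 t ⟨le_rfl, ht.le⟩)
  by_cases hmono : StrictMono y
  · obtain ⟨a, ha, ha', hax⟩ := exists_forall_lt_iff_lt ht hy
      (Finset.univ.filter fun i => i.castSucc < l)
    obtain ⟨b, hb, hb', hbx⟩ := exists_forall_gt_iff_gt ht hy
      (Finset.univ.filter fun i => l ≤ i.castSucc)
    simp only [Finset.mem_filter, Finset.mem_univ, true_and] at hax hbx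
    have hp : ∀ x ∈ Set.Ioo t T,
        StrictMono (l.insertNth x y : Fin (k + 1) → ℝ) ↔ a < x ∧ x < b := fun x hx => by
      rw [strictMono_insertNth_iff hmono, hax x hx.1, hbx x hx.2]
    have hΦ : ∀ c, (legendreSysPrimitive t T n c = 0 ∨ ∃ i, c = y i) →
        legendreSysPrimitive t T n c ^ 2 ≤ ∑ i, legendreSysPrimitive t T n (y i) ^ 2 := by
      rintro c (hc | ⟨i, rfl⟩)
      · rw [hc]; simpa using hS
      · exact Finset.single_le_sum (f := fun i => legendreSysPrimitive t T n (y i) ^ 2)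
          (fun i _ => sq_nonneg _) (Finset.mem_univ i)
    have hΦa := hΦ a (ha'.imp_left fun h => by rw [h, legendreSysPrimitive_left ht])
    have hΦb := hΦ b (hb'.imp_left fun h => by rw [h, legendreSysPrimitive_right ht])
    have hI := sq_integral_abs_le ht (continuous_legendreSysPrimitive t T n)
    have hslice := abs_integral_ite_mul_legendreSys_le ht (hg' l) (hg l) (hM l) (hM' l) hn ha hb hp
    have hprod : |∏ i, g (l.succAbove i) (y i)| ≤ M ^ k := by
      rw [Finset.abs_prod]
      calc ∏ i, |g (l.succAbove i) (y i)| ≤ ∏ _i : Fin k, M :=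
            Finset.prod_le_prod (fun _ _ => abs_nonneg _) fun i _ => hM _ _ (hy i)
        _ = M ^ k := by simp
    have e : sliceCoef t T (kernelK g) l n y = (∏ i, g (l.succAbove i) (y i)) *
        ∫ x in Set.Icc t T, if StrictMono (l.insertNth x y : Fin (k + 1) → ℝ) then
          g l x * legendreSys t T n x else 0 := by
      rw [sliceCoef, ← integral_const_mul]
      congr 1
      ext x
      simp only [kernelK, Fin.prod_univ_succAbove _ l, Fin.insertNth_apply_same,
        Fin.insertNth_apply_succAbove]
      split_ifs <;> ring
    set I := ∫ x in t..T, |legendreSysPrimitive t T n x|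
    have habs : |sliceCoef t T (kernelK g) l n y| ≤ M ^ (k + 1) *
        (|legendreSysPrimitive t T n a| + |legendreSysPrimitive t T n b| + I) := by
      rw [e, abs_mul, pow_succ, mul_assoc]
      gcongr
    rw [← sq_abs (sliceCoef _ _ _ _ _ _)]
    calc |sliceCoef t T (kernelK g) l n y| ^ 2 ≤ (M ^ (k + 1) *
        (|legendreSysPrimitive t T n a| + |legendreSysPrimitive t T n b| + I)) ^ 2 := by gcongr
      _ = (M ^ (k + 1)) ^ 2 *
        (|legendreSysPrimitive t T n a| + |legendreSysPrimitive t T n b| + I) ^ 2 := mul_pow _ _ _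
      _ ≤ _ := by
        gcongr
        rw [← sq_abs] at hΦa hΦb
        nlinarith [sq_nonneg (|legendreSysPrimitive t T n a| - |legendreSysPrimitive t T n b|),
          sq_nonneg (|legendreSysPrimitive t T n a| - I),
          sq_nonneg (|legendreSysPrimitive t T n b| - I)]
  · have : sliceCoef t T (kernelK g) l n y = 0 := by
      rw [sliceCoef]
      refine integral_eq_zero_of_ae (ae_of_all _ fun x => ?_)
      have h : ¬StrictMono (l.insertNth x y : Fin (k + 1) → ℝ) := fun h =>
        hmono (strictMono_of_strictMono_insertNth h)
      simp only [kernelK, if_neg h, zero_mul, Pi.zero_apply]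
    rw [this, zero_pow two_ne_zero]
    positivity

theorem integral_boxMeasure_comp_eval (ht : t < T) {f : ℝ → ℝ} (hf : Continuous f) (i : Fin k) :
    ∫ y, f (y i) ∂boxMeasure t T k = (T - t) ^ (k - 1) * ∫ x in t..T, f x := by
  have h := integral_map (μ := boxMeasure t T k) (φ := Function.eval i) (f := f)
    (measurable_pi_apply i).aemeasurable hf.aestronglyMeasurable
  rw [boxMeasure, Measure.pi_map_eval, integral_smul_measure, integral_restrict_Icc ht.le] at h
  rw [boxMeasure]
  refine h.symm.trans ?_
  simp [Finset.card_erase_of_mem, ht.le]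

theorem exists_integral_sq_sliceCoef_kernelK_le (ht : t < T) {g g' : Fin (k + 1) → ℝ → ℝ}
    (hg' : ∀ l, Continuous (g' l)) (hg : ∀ l x, HasDerivAt (g l) (g' l x) x) :
    ∃ A : ℝ, ∀ (l : Fin (k + 1)) (n : ℕ), n ≠ 0 →
      MemLp (sliceCoef t T (kernelK g) l n) 2 (boxMeasure t T k) ∧
      ∫ y, sliceCoef t T (kernelK g) l n y ^ 2 ∂boxMeasure t T k ≤ A / (n * (n + 1)) := by
  have hgc : ∀ l, Continuous (g l) := fun l =>
    continuous_iff_continuousAt.2 fun x => (hg l x).continuousAt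
  obtain ⟨M, hM⟩ : ∃ M, ∀ l, ∀ x ∈ Set.Icc t T, |g l x| ≤ M ∧ |g' l x| ≤ M := by
    have h : ∀ l, ∃ M, ∀ x ∈ Set.Icc t T, |g l x| ≤ M ∧ |g' l x| ≤ M := fun l => by
      obtain ⟨M₁, h₁⟩ := isCompact_Icc.exists_bound_of_continuousOn (hgc l).continuousOn
      obtain ⟨M₂, h₂⟩ := isCompact_Icc.exists_bound_of_continuousOn (hg' l).continuousOn
      exact ⟨max M₁ M₂, fun x hx => ⟨(h₁ x hx).trans (le_max_left _ _),
        (h₂ x hx).trans (le_max_right _ _)⟩⟩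
    choose M hM using h
    obtain ⟨B, hB⟩ := Finite.exists_le M
    exact ⟨B, fun l x hx => ⟨(hM l x hx).1.trans (hB l), (hM l x hx).2.trans (hB l)⟩⟩
  have hd : 0 < T - t := sub_pos.2 ht
  set D := (M ^ (k + 1)) ^ 2 * (3 * (2 * (k * (T - t) ^ (k - 1)) + (T - t) ^ k * (T - t)))
    with hD
  have hD0 : 0 ≤ D := by positivity
  refine ⟨D * ((T - t) ^ 2 / 4), fun l n hn => ?_⟩
  set J := ∫ x in t..T, legendreSysPrimitive t T n x ^ 2 with hJ
  have hΦ := continuous_legendreSysPrimitive t T n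
  have hcont : Continuous fun y : Fin k → ℝ => (M ^ (k + 1)) ^ 2 * (3 *
      (2 * ∑ i, legendreSysPrimitive t T n (y i) ^ 2 + (T - t) * J)) := by
    fun_prop
  have hint := (memLp_boxMeasure_of_continuous (t := t) (T := T) hcont 1).integrable le_rfl
  have hle : ∀ᵐ y ∂boxMeasure t T k, sliceCoef t T (kernelK g) l n y ^ 2 ≤
      (M ^ (k + 1)) ^ 2 * (3 *
        (2 * ∑ i, legendreSysPrimitive t T n (y i) ^ 2 + (T - t) * J)) := by
    filter_upwards [ae_boxMeasure_mem t T k] with y hy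
    exact sq_sliceCoef_kernelK_le ht hg' hg (fun l x hx => (hM l x hx).1)
      (fun l x hx => (hM l x hx).2) l hn hy
  have hmeas := aestronglyMeasurable_sliceCoef (t := t) (T := T) (measurable_kernelK hgc) l n
  have hsq : Integrable (fun y => sliceCoef t T (kernelK g) l n y ^ 2) (boxMeasure t T k) :=
    hint.mono' (hmeas.pow 2) (by
      filter_upwards [hle] with y hy
      rwa [Real.norm_of_nonneg (sq_nonneg _)])
  refine ⟨(memLp_two_iff_integrable_sq hmeas).2 hsq, ?_⟩
  have hbox : (boxMeasure t T k).real Set.univ = (T - t) ^ k := by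
    rw [boxMeasure, measureReal_def, Measure.pi_univ]
    simp [ht.le]
  calc ∫ y, sliceCoef t T (kernelK g) l n y ^ 2 ∂boxMeasure t T k
      ≤ ∫ y, (M ^ (k + 1)) ^ 2 * (3 * (2 * ∑ i, legendreSysPrimitive t T n (y i) ^ 2 +
          (T - t) * J)) ∂boxMeasure t T k := integral_mono_ae hsq hint hle
    _ = D * J := by
      have h1 : ∀ i : Fin k, Integrable (fun y : Fin k → ℝ => legendreSysPrimitive t T n (y i) ^ 2)
          (boxMeasure t T k) := fun i =>
        (memLp_boxMeasure_of_continuous (by fun_prop) 1).integrable le_rfl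
      rw [integral_const_mul, integral_const_mul, integral_add
        ((integrable_finsetSum _ fun i _ => h1 i).const_mul _) (integrable_const _),
        integral_const_mul, integral_finsetSum _ fun i _ => h1 i, integral_const, hbox]
      have h2 : ∀ i : Fin k, ∫ y, legendreSysPrimitive t T n (y i) ^ 2 ∂boxMeasure t T k =
          (T - t) ^ (k - 1) * J := integral_boxMeasure_comp_eval ht (hΦ.pow 2)
      simp only [h2, Finset.sum_const,
        Finset.card_univ, Fintype.card_fin, nsmul_eq_mul, smul_eq_mul, hD]
      ring
    _ ≤ D * ((T - t) ^ 2 / 4 / (n * (n + 1))) := by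
      gcongr
      exact integral_legendreSysPrimitive_sq_le ht hn
    _ = _ := by ring

theorem integral_mul_legendreTensor_insertNth {F : (Fin (k + 1) → ℝ) → ℝ}
    (hF : MemLp F 2 (boxMeasure t T (k + 1))) (l : Fin (k + 1)) (n : ℕ) (j : Fin k → ℕ) :
    ∫ x, F x * legendreTensor t T (l.insertNth n j) x ∂boxMeasure t T (k + 1) =
      ∫ y, sliceCoef t T F l n y * legendreTensor t T j y ∂boxMeasure t T k := by
  have hint : Integrable (fun x => F x * legendreTensor t T (l.insertNth n j) x)
      (boxMeasure t T (k + 1)) := hF.integrable_mul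
    (memLp_boxMeasure_of_continuous (continuous_legendreTensor t T (l.insertNth n j)) 2)
  rw [integral_boxMeasure_succ l, integral_prod_symm _ (integrable_boxMeasure_succ l hint)]
  refine integral_congr_ae (ae_of_all _ fun y => ?_)
  simp only [sliceCoef, ← integral_mul_const]
  refine integral_congr_ae (ae_of_all _ fun x => ?_)
  simp only [legendreTensor, Fin.prod_univ_succAbove _ l, Fin.insertNth_apply_same,
    Fin.insertNth_apply_succAbove]
  ring

end Kernel

section Truncation

variable {k : ℕ}

theorem sum_Ioc_inv_mul_succ_le {p : ℕ} (hp : 1 ≤ p) (q : ℕ) :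
    ∑ n ∈ Finset.Ioc p q, (1 : ℝ) / (n * (n + 1)) ≤ 1 / p := by
  have hp0 : (0 : ℝ) < p := by exact_mod_cast hp
  have h : ∀ q, p ≤ q →
      ∑ n ∈ Finset.Ioc p q, (1 : ℝ) / (n * (n + 1)) ≤ 1 / p - 1 / (q + 1) := by
    intro q hq
    induction q, hq using Nat.le_induction with
    | base =>
      simp only [Finset.Ioc_self, Finset.sum_empty, sub_nonneg]
      gcongr
      linarith
    | succ q hq ih =>
      rw [Finset.sum_Ioc_succ_top (by omega)]
      have : (1 : ℝ) / (((q + 1 : ℕ) : ℝ) * (((q + 1 : ℕ) : ℝ) + 1)) =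
          1 / (q + 1) - 1 / (((q + 1 : ℕ) : ℝ) + 1) := by
        push_cast
        field_simp
        ring
      linarith
  rcases le_total p q with hq | hq
  · refine (h q hq).trans (sub_le_self _ (by positivity))
  · rw [Finset.Ioc_eq_empty_of_le hq]
    simp only [Finset.sum_empty]
    positivity

theorem sum_filter_apply_eq_le {c : (Fin (k + 1) → ℕ) → ℝ} {l : Fin (k + 1)} {n : ℕ} {a : ℝ}
    (h : ∀ s : Finset (Fin k → ℕ), ∑ j ∈ s, c (l.insertNth n j) ≤ a)
    (s : Finset (Fin (k + 1) → ℕ)) : ∑ j ∈ s with j l = n, c j ≤ a := by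
  refine le_of_eq_of_le ?_ (h ((s.filter fun j => j l = n).image l.removeNth))
  have e : ∀ j ∈ s.filter (fun j => j l = n), l.insertNth n (l.removeNth j) = j := fun j hj => by
    rw [← (Finset.mem_filter.1 hj).2, Fin.insertNth_self_removeNth]
  rw [Finset.sum_image fun i hi j hj hij => by rw [← e i hi, ← e j hj, hij]]
  exact Finset.sum_congr rfl fun j hj => by rw [e j hj]

theorem sum_le_sum_piFinset_range_add {c : (Fin (k + 1) → ℕ) → ℝ} (hc : ∀ j, 0 ≤ c j) {A : ℝ}
    (h : ∀ (l : Fin (k + 1)) (n : ℕ), n ≠ 0 →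
      ∀ s : Finset (Fin k → ℕ), ∑ j ∈ s, c (l.insertNth n j) ≤ A / (n * (n + 1)))
    {p : ℕ} (hp : 1 ≤ p) (s : Finset (Fin (k + 1) → ℕ)) :
    ∑ j ∈ s, c j ≤
      ∑ j ∈ Fintype.piFinset fun _ => Finset.range (p + 1), c j + (k + 1) * A / p := by
  have hA : 0 ≤ A := by
    have := h 0 1 one_ne_zero ∅
    norm_num at this
    linarith
  set B : Finset (Fin (k + 1) → ℕ) := Fintype.piFinset fun _ => Finset.range (p + 1) with hB
  obtain ⟨q, hq⟩ : ∃ q, ∀ j ∈ s, ∀ l, j l ≤ q := by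
    refine ⟨s.sup fun j => Finset.univ.sup j, fun j hj l => ?_⟩
    exact (Finset.le_sup (f := j) (Finset.mem_univ l)).trans
      (Finset.le_sup (f := fun j : Fin (k + 1) → ℕ => Finset.univ.sup j) hj)
  have h1 : ∑ j ∈ s with j ∈ B, c j ≤ ∑ j ∈ B, c j :=
    Finset.sum_le_sum_of_subset_of_nonneg (fun j hj => (Finset.mem_filter.1 hj).2)
      fun j _ _ => hc j
  have h2 : ∑ j ∈ s with j ∉ B, c j ≤
      ∑ l : Fin (k + 1), ∑ n ∈ Finset.Ioc p q, ∑ j ∈ s with j l = n, c j := by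
    have e : ∀ j ∈ s.filter (· ∉ B), c j ≤
        ∑ l : Fin (k + 1), ∑ n ∈ Finset.Ioc p q, if j l = n then c j else 0 := by
      intro j hj
      obtain ⟨hjs, hjB⟩ := Finset.mem_filter.1 hj
      simp only [hB, Fintype.mem_piFinset, Finset.mem_range, not_forall] at hjB
      obtain ⟨l, hl⟩ := hjB
      have hnn : ∀ l', 0 ≤ ∑ n ∈ Finset.Ioc p q, if j l' = n then c j else 0 := fun l' =>
        Finset.sum_nonneg fun n _ => by split_ifs <;> simp [hc]
      refine le_trans ?_ (Finset.single_le_sum (fun l' _ => hnn l') (Finset.mem_univ l))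
      rw [Finset.sum_ite_eq, if_pos (Finset.mem_Ioc.2 ⟨by omega, hq j hjs l⟩)]
    calc ∑ j ∈ s with j ∉ B, c j
        ≤ ∑ j ∈ s with j ∉ B, ∑ l : Fin (k + 1), ∑ n ∈ Finset.Ioc p q,
            if j l = n then c j else 0 := Finset.sum_le_sum e
      _ ≤ ∑ j ∈ s, ∑ l : Fin (k + 1), ∑ n ∈ Finset.Ioc p q, if j l = n then c j else 0 :=
          Finset.sum_le_sum_of_subset_of_nonneg (Finset.filter_subset _ _) fun j _ _ =>
            Finset.sum_nonneg fun l _ => Finset.sum_nonneg fun n _ => by split_ifs <;> simp [hc]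
      _ = _ := by
          rw [Finset.sum_comm]
          refine Finset.sum_congr rfl fun l _ => ?_
          rw [Finset.sum_comm]
          exact Finset.sum_congr rfl fun n _ => (Finset.sum_filter _ _).symm
  have h3 : ∀ l : Fin (k + 1), ∑ n ∈ Finset.Ioc p q, ∑ j ∈ s with j l = n, c j ≤ A / p := by
    intro l
    calc ∑ n ∈ Finset.Ioc p q, ∑ j ∈ s with j l = n, c j
        ≤ ∑ n ∈ Finset.Ioc p q, A * (1 / (n * (n + 1))) := by
          refine Finset.sum_le_sum fun n hn => ?_
          rw [mul_one_div]
          exact sum_filter_apply_eq_le (h l n (by have := Finset.mem_Ioc.1 hn; omega)) s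
      _ ≤ A * (1 / p) := by
          rw [← Finset.mul_sum]
          exact mul_le_mul_of_nonneg_left (sum_Ioc_inv_mul_succ_le hp q) hA
      _ = A / p := mul_one_div _ _
  have h4 : ∑ l : Fin (k + 1), ∑ n ∈ Finset.Ioc p q, ∑ j ∈ s with j l = n, c j ≤
      (k + 1) * A / p := by
    refine (Finset.sum_le_sum fun l _ => h3 l).trans_eq ?_
    simp only [Finset.sum_const, Finset.card_univ, Fintype.card_fin, nsmul_eq_mul]
    push_cast
    ring
  rw [← Finset.sum_filter_add_sum_filter_not s (· ∈ B)]
  linarith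

theorem sum_fin_eq_sum_piFinset_range (c : (Fin k → ℕ) → ℝ) (p : ℕ) :
    ∑ j : Fin k → Fin p, c (fun l => (j l : ℕ)) =
      ∑ j ∈ Fintype.piFinset fun _ => Finset.range p, c j := by
  refine Finset.sum_bij (fun j _ l => (j l : ℕ)) (fun j _ => ?_) (fun i _ j _ h => ?_)
    (fun j hj => ?_) fun _ _ => rfl
  · simp [Fintype.mem_piFinset]
  · exact funext fun l => Fin.ext (congrFun h l)
  · simp only [Fintype.mem_piFinset, Finset.mem_range] at hj
    exact ⟨fun l => ⟨j l, hj l⟩, Finset.mem_univ _, rfl⟩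

end Truncation

section Coefficients

variable {t T : ℝ} {k : ℕ}

theorem legCoef_eq_integral_kernelK_mul (ht : t < T) {ψ g : Fin k → ℝ → ℝ}
    (hg : ∀ l, Continuous (g l)) (hψ : ∀ l, ∀ x ∈ Set.Icc t T, ψ l x = g l x) (j : Fin k → ℕ) :
    legCoef t T ψ j = ∫ x, kernelK g x * legendreTensor t T j x ∂boxMeasure t T k := by
  rw [legCoef, simplexIntegral_eq_integral_boxMeasure _
    (fun l s => g l s * legendreSys t T (j l) s)
    (fun l => (hg l).mul (continuous_legendreSys t T (j l)))
    (fun l x hx => by rw [hψ l x hx]) ⟨ht.le, le_rfl⟩]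
  refine integral_congr_ae ?_
  have hne : ∀ᵐ x ∂boxMeasure t T k, ∀ i, x i ≠ T :=
    ae_all_iff.2 fun i => Measure.ae_eval_ne (fun _ => volume.restrict (Set.Icc t T)) i T
  filter_upwards [ae_boxMeasure_mem t T k, hne] with x hx hxT
  have hlt : ∀ i, x i < T := fun i => lt_of_le_of_ne (hx i).2 (hxT i)
  simp only [hlt, implies_true, and_true, kernelK, legendreTensor, Finset.prod_mul_distrib,
    ite_mul, zero_mul]

theorem integral_kernelK_sq_congr {ψ g : Fin k → ℝ → ℝ}
    (hψ : ∀ l, ∀ x ∈ Set.Icc t T, ψ l x = g l x) :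
    ∫ x, kernelK ψ x ^ 2 ∂boxMeasure t T k = ∫ x, kernelK g x ^ 2 ∂boxMeasure t T k := by
  refine integral_congr_ae ?_
  filter_upwards [ae_boxMeasure_mem t T k] with x hx
  simp only [kernelK, hψ _ _ (hx _)]

theorem exists_integral_kernelK_sq_sub_sum_legCoef_sq_le (ht : t < T)
    {ψ : Fin (k + 1) → ℝ → ℝ} (hψ : ∀ l, ContDiffOn ℝ 1 (ψ l) (Set.Icc t T)) :
    ∃ C : ℝ, 0 ≤ C ∧ ∀ p : ℕ, 1 ≤ p →
      0 ≤ (∫ x, kernelK ψ x ^ 2 ∂boxMeasure t T (k + 1)) -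
        ∑ j : Fin (k + 1) → Fin (p + 1), legCoef t T ψ (fun l => (j l : ℕ)) ^ 2 ∧
      (∫ x, kernelK ψ x ^ 2 ∂boxMeasure t T (k + 1)) -
        ∑ j : Fin (k + 1) → Fin (p + 1), legCoef t T ψ (fun l => (j l : ℕ)) ^ 2 ≤ C / p := by
  choose g g' hg' hg hψg using fun l => exists_contDiff_extension ht (hψ l)
  have hgc : ∀ l, Continuous (g l) := fun l =>
    continuous_iff_continuousAt.2 fun x => (hg l x).continuousAt
  have hK := memLp_kernelK (t := t) (T := T) hgc
  obtain ⟨A, hA⟩ := exists_integral_sq_sliceCoef_kernelK_le ht hg' hg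
  have hslice : ∀ (l : Fin (k + 1)) (n : ℕ), n ≠ 0 → ∀ s : Finset (Fin k → ℕ),
      ∑ j ∈ s, legCoef t T ψ (l.insertNth n j) ^ 2 ≤ A / (n * (n + 1)) := by
    intro l n hn s
    simp only [legCoef_eq_integral_kernelK_mul ht hgc hψg, integral_mul_legendreTensor_insertNth hK]
    exact (sum_sq_integral_mul_legendreTensor_le ht (hA l n hn).1 s).trans (hA l n hn).2
  have hA0 : 0 ≤ A := by
    have := hslice 0 1 one_ne_zero ∅
    norm_num at this
    linarith
  refine ⟨(k + 1) * A, by positivity, fun p hp => ?_⟩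
  rw [sum_fin_eq_sum_piFinset_range (fun j => legCoef t T ψ j ^ 2), integral_kernelK_sq_congr hψg]
  have hsum : HasSum (fun j => legCoef t T ψ j ^ 2)
      (∫ x, kernelK g x ^ 2 ∂boxMeasure t T (k + 1)) := by
    simpa only [legCoef_eq_integral_kernelK_mul ht hgc hψg] using
      hasSum_sq_integral_mul_legendreTensor ht hK
  refine ⟨sub_nonneg.2 (sum_le_hasSum _ (fun j _ => sq_nonneg _) hsum), ?_⟩
  rw [sub_le_iff_le_add']
  exact hasSum_le_of_sum_le hsum
    (sum_le_sum_piFinset_range_add (fun j => sq_nonneg (legCoef t T ψ j)) hslice hp)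

end Coefficients

theorem stmt_18 (t T : ℝ) (ht : t < T) (ψ : Fin 5 → ℝ → ℝ)
    (hψ : ∀ l, ContDiffOn ℝ 1 (ψ l) (Set.Icc t T)) :
    ∀ ε : ℝ, 0 < ε → ε < 1 →
      ∃ C : ℝ, ∀ p : ℕ, 1 ≤ p →
        (0 ≤ (∫ x, (kernelK ψ x) ^ 2 ∂(boxMeasure t T 5)) -
            ∑ j : Fin 5 → Fin (p + 1), (legCoef t T ψ fun l => (j l : ℕ)) ^ 2) ∧
        (∫ x, (kernelK ψ x) ^ 2 ∂(boxMeasure t T 5)) -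
            ∑ j : Fin 5 → Fin (p + 1), (legCoef t T ψ fun l => (j l : ℕ)) ^ 2 ≤
          C / (p : ℝ) ^ (1 - ε) := by
  intro ε hε _
  obtain ⟨C, hC, h⟩ := exists_integral_kernelK_sq_sub_sum_legCoef_sq_le ht hψ
  refine ⟨C, fun p hp => ⟨(h p hp).1, (h p hp).2.trans ?_⟩⟩
  have hp1 : (1 : ℝ) ≤ p := by exact_mod_cast hp
  have hpow : (p : ℝ) ^ (1 - ε) ≤ p := by
    simpa using Real.rpow_le_rpow_of_exponent_le hp1 (sub_le_self 1 hε.le)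
  exact div_le_div_of_nonneg_left hC (Real.rpow_pos_of_pos (by linarith) _) hpow
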